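/- (Main Theorem) Let X be a special (abstract) rank one group with unipotent subgroups A and B, and suppose the unipotent subgroups have size at least 4, i.e., |A| ≥ 4. Then X is perfect: X = [X,X]. -/

import Mathlib

/-- The conjugate subgroup `S^g = g⁻¹ S g`. -/
def conjSub {X : Type*} [Group X] (S : Subgroup X) (g : X) : Subgroup X :=
  S.map (MulAut.conj g⁻¹).toMonoidHom

/-- `X` is an (abstract) rank one group with unipotent subgroups `A` and `B`:
`A ≠ B`, `X = ⟨A, B⟩`, for each `1 ≠ a ∈ A` there is `1 ≠ b ∈ B` with `A^b = B^a`,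
and vice versa. -/
structure IsRankOneGroup {X : Type*} [Group X] (A B : Subgroup X) : Prop where
  ne : A ≠ B
  gen : A ⊔ B = ⊤
  exB : ∀ a ∈ A, a ≠ 1 → ∃ b ∈ B, b ≠ 1 ∧ conjSub A b = conjSub B a
  exA : ∀ b ∈ B, b ≠ 1 → ∃ a ∈ A, a ≠ 1 ∧ conjSub B a = conjSub A b

/-- `bf` implements `a ↦ b(a)`, the unique `1 ≠ b ∈ B` with `A^b = B^a`, for `1 ≠ a ∈ A`. -/
def IsBFun {X : Type*} [Group X] (A B : Subgroup X) (bf : X → X) : Prop :=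
  ∀ a ∈ A, a ≠ 1 → bf a ∈ B ∧ bf a ≠ 1 ∧ conjSub A (bf a) = conjSub B a

/-- `af` implements `b ↦ a(b)`, the unique `1 ≠ a ∈ A` with `B^a = A^b`, for `1 ≠ b ∈ B`. -/
def IsAFun {X : Type*} [Group X] (A B : Subgroup X) (af : X → X) : Prop :=
  ∀ b ∈ B, b ≠ 1 → af b ∈ A ∧ af b ≠ 1 ∧ conjSub B (af b) = conjSub A b

/-- `X` is special: `b(a⁻¹) = b(a)⁻¹` for all `1 ≠ a ∈ A`. -/
def IsSpecialBFun {X : Type*} [Group X] (A B : Subgroup X) (bf : X → X) : Prop :=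
  IsBFun A B bf ∧ ∀ a ∈ A, a ≠ 1 → bf a⁻¹ = (bf a)⁻¹

/-- The special rank one group condition, phrased without a chosen `b`-function. -/
def IsSpecial {X : Type*} [Group X] (A B : Subgroup X) : Prop :=
  ∃ bf : X → X, IsSpecialBFun A B bf

theorem mem_conjSub_iff {X : Type*} [Group X] {S : Subgroup X} {g x : X} :
    x ∈ conjSub S g ↔ g * x * g⁻¹ ∈ S := by
  constructor
  · rintro ⟨s, hs, rfl⟩
    simpa [mul_assoc] using hs
  · intro hx
    exact ⟨_, hx, by simp [mul_assoc]⟩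

theorem conjSub_mul {X : Type*} [Group X] (S : Subgroup X) (g k : X) :
    conjSub S (g * k) = conjSub (conjSub S g) k := by
  ext x
  simp [mem_conjSub_iff, mul_assoc]

theorem conjSub_one {X : Type*} [Group X] (S : Subgroup X) : conjSub S 1 = S := by
  ext x
  simp [mem_conjSub_iff]

theorem conjSub_of_mem {X : Type*} [Group X] {S : Subgroup X} {s : X} (hs : s ∈ S) :
    conjSub S s = S := by
  ext x
  rw [mem_conjSub_iff, S.mul_mem_cancel_right (inv_mem hs), S.mul_mem_cancel_left hs]

theorem conjSub_eq_iff {X : Type*} [Group X] {S T : Subgroup X} {g : X} :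
    conjSub S g = T ↔ S = conjSub T g⁻¹ := by
  constructor
  · rintro rfl
    rw [← conjSub_mul, mul_inv_cancel, conjSub_one]
  · rintro rfl
    rw [← conjSub_mul, inv_mul_cancel, conjSub_one]

theorem exists_mem_ne_of_four_le {X : Type*} [Group X] {A : Subgroup X}
    (hcard : 4 ≤ Cardinal.mk A) (a : X) : ∃ x ∈ A, x ≠ 1 ∧ x ≠ a ∧ x ≠ a⁻¹ := by
  classical
  by_contra! hne
  have hsub : (A : Set X) ⊆ (({1, a, a⁻¹} : Finset X) : Set X) := fun x hx => by
    simpa [or_iff_not_imp_left] using hne x hx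
  have hle := hcard.trans (Cardinal.mk_le_mk_of_subset hsub)
  rw [Finset.coe_sort_coe, Cardinal.mk_coe_finset] at hle
  have h4 : 4 ≤ ({1, a, a⁻¹} : Finset X).card := by exact_mod_cast hle
  exact absurd (h4.trans Finset.card_le_three) (by norm_num)

namespace IsRankOneGroup

variable {X : Type*} [Group X] {A B : Subgroup X}

theorem symm (h : IsRankOneGroup A B) : IsRankOneGroup B A :=
  ⟨h.ne.symm, sup_comm A B ▸ h.gen, h.exA, h.exB⟩

/-- The normalizer of `A` in `B` is trivial. -/
theorem eq_one_of_conjSub_eq (h : IsRankOneGroup A B) {b : X} (hb : b ∈ B)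
    (e : conjSub A b = A) : b = 1 := by
  by_contra hb1
  obtain ⟨a, ha, -, e'⟩ := h.exA b hb hb1
  rw [e, conjSub_eq_iff, conjSub_of_mem (inv_mem ha)] at e'
  exact h.ne e'.symm

theorem eq_of_conjSub_eq (h : IsRankOneGroup A B) {b c : X} (hb : b ∈ B) (hc : c ∈ B)
    (e : conjSub A b = conjSub A c) : b = c := by
  refine mul_inv_eq_one.mp (h.eq_one_of_conjSub_eq (mul_mem hb (inv_mem hc)) ?_)
  rw [conjSub_mul, e, ← conjSub_mul, mul_inv_cancel, conjSub_one]

variable {bf : X → X}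

theorem conjSub_inv_eq (h : IsRankOneGroup A B) (hb : IsBFun A B bf)
    (hinv : ∀ a ∈ A, a ≠ 1 → bf a⁻¹ = (bf a)⁻¹) {a b : X} (ha : a ∈ A) (ha1 : a ≠ 1)
    (hbB : b ∈ B) (e : conjSub A b = conjSub B a) : conjSub A b⁻¹ = conjSub B a⁻¹ := by
  obtain ⟨hm, -, e'⟩ := hb a ha ha1
  rw [h.eq_of_conjSub_eq hbB hm (e.trans e'.symm), ← hinv a ha ha1]
  exact (hb a⁻¹ (inv_mem ha) (inv_ne_one.mpr ha1)).2.2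

/-- In a special rank one group, `a ^ b(a) = (b(a)⁻¹) ^ a`. -/
theorem conj_eq_conj (h : IsRankOneGroup A B) (hb : IsBFun A B bf)
    (hinv : ∀ a ∈ A, a ≠ 1 → bf a⁻¹ = (bf a)⁻¹) {a b : X} (ha : a ∈ A) (ha1 : a ≠ 1)
    (hbB : b ∈ B) (e : conjSub A b = conjSub B a) : b⁻¹ * a * b = a⁻¹ * b⁻¹ * a := by
  have ei := h.conjSub_inv_eq hb hinv ha ha1 hbB e
  have hmem : a * (b⁻¹ * a * b) * a⁻¹ ∈ B := by
    rw [← mem_conjSub_iff, ← e, mem_conjSub_iff]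
    simpa [mul_assoc] using ha
  have key : a * (b⁻¹ * a * b) * a⁻¹ = b⁻¹ := by
    refine h.eq_of_conjSub_eq hmem (inv_mem hbB) ?_
    rw [show a * (b⁻¹ * a * b) * a⁻¹ = a * b⁻¹ * a * b * a⁻¹ by group, conjSub_mul, conjSub_mul,
      conjSub_mul, conjSub_mul, conjSub_of_mem ha, ei, ← conjSub_mul B, inv_mul_cancel,
      conjSub_one, conjSub_of_mem hbB]
  rw [show a⁻¹ * b⁻¹ * a = a⁻¹ * (a * (b⁻¹ * a * b) * a⁻¹) * a by rw [key]]
  group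

theorem map_eq_inv {G : Type*} [CommGroup G] (h : IsRankOneGroup A B) (hb : IsBFun A B bf)
    (hinv : ∀ a ∈ A, a ≠ 1 → bf a⁻¹ = (bf a)⁻¹) (f : X →* G) {a b : X} (ha : a ∈ A)
    (ha1 : a ≠ 1) (hbB : b ∈ B) (e : conjSub A b = conjSub B a) : f b = (f a)⁻¹ := by
  have key := congrArg f (h.conj_eq_conj hb hinv ha ha1 hbB e)
  simp only [map_mul, map_inv] at key
  rw [mul_right_comm, inv_mul_cancel, one_mul, mul_right_comm, inv_mul_cancel, one_mul] at key
  rw [key, inv_inv]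

/-- Any homomorphism `f` from a special rank one group to a commutative group satisfies
`f x ^ 2 * f a = 1` for nontrivial `x, a ∈ A` with `x * a ≠ 1`. -/
theorem map_relation {G : Type*} [CommGroup G] (h : IsRankOneGroup A B) (hb : IsBFun A B bf)
    (hinv : ∀ a ∈ A, a ≠ 1 → bf a⁻¹ = (bf a)⁻¹) (f : X →* G) {x a : X} (hx : x ∈ A)
    (hx1 : x ≠ 1) (ha : a ∈ A) (ha1 : a ≠ 1) (hxa : x * a ≠ 1) : f x * f x * f a = 1 := by
  obtain ⟨hpB, -, ep⟩ := hb _ (mul_mem hx ha) hxa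
  obtain ⟨hqB, -, eqa⟩ := hb a ha ha1
  obtain ⟨hrB, -, er⟩ := hb x hx hx1
  set p := bf (x * a)
  set q := bf a
  set r := bf x
  have hc : p * q⁻¹ ∈ B := mul_mem hpB (inv_mem hqB)
  have hc1 : p * q⁻¹ ≠ 1 := fun hpq => by
    rw [mul_inv_eq_one.mp hpq, eqa] at ep
    exact hx1 (mul_eq_right.mp (h.symm.eq_of_conjSub_eq ha (mul_mem hx ha) ep).symm)
  obtain ⟨d, hd, hd1, ed⟩ := h.exA _ hc hc1
  -- `a * q⁻¹ * a` interchanges `A` and `B`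
  have hswapA : conjSub A (a * q⁻¹ * a) = B := by
    rw [conjSub_mul, conjSub_mul, conjSub_of_mem ha,
      h.conjSub_inv_eq hb hinv ha ha1 hqB eqa, ← conjSub_mul, inv_mul_cancel, conjSub_one]
  have hswapB : conjSub B (a * q⁻¹ * a) = A := by
    rw [conjSub_mul, conjSub_mul, ← eqa, ← conjSub_mul A, mul_inv_cancel, conjSub_one,
      conjSub_of_mem ha]
  have hmem : (a * q⁻¹ * a)⁻¹ * r * (a * q⁻¹ * a) ∈ A := by
    rw [← hswapB, mem_conjSub_iff]
    simpa [mul_assoc] using hrB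
  have key : (a * q⁻¹ * a)⁻¹ * r * (a * q⁻¹ * a) = d * a := by
    refine h.symm.eq_of_conjSub_eq hmem (mul_mem hd ha) ?_
    rw [conjSub_mul _ _ (a * q⁻¹ * a), conjSub_mul _ _ r, ← conjSub_eq_iff.mp hswapA, er, ← conjSub_mul,
      show x * (a * q⁻¹ * a) = x * a * q⁻¹ * a by group, conjSub_mul, conjSub_mul, ← ep,
      ← conjSub_mul A, ← ed, ← conjSub_mul]
  have hfr := h.map_eq_inv hb hinv f hx hx1 hrB er
  have hfc := h.map_eq_inv hb hinv f hd hd1 hc ed.symm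
  have hfp := h.map_eq_inv hb hinv f (mul_mem hx ha) hxa hpB ep
  have hfq := h.map_eq_inv hb hinv f ha ha1 hqB eqa
  have hfd : f d = f x := by
    rw [map_mul, map_inv, hfp, hfq, map_mul, inv_inv, mul_inv, inv_mul_cancel_right] at hfc
    exact (inv_injective hfc).symm
  have hfk := congrArg f key
  rw [map_mul, map_mul, map_inv, mul_right_comm, inv_mul_cancel, one_mul, hfr, map_mul, hfd] at hfk
  rw [mul_assoc, ← hfk, mul_inv_cancel]

end IsRankOneGroup


/-- Main Theorem: a special rank one group with unipotent subgroups of size at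
least 4 is perfect. -/
theorem specialRankOne_perfect {X : Type*} [Group X] (A B : Subgroup X)
    (h : IsRankOneGroup A B) (hsp : IsSpecial A B)
    (hcard : 4 ≤ Cardinal.mk A) :
    commutator X = ⊤ := by
  obtain ⟨bf, hb, hinv⟩ := hsp
  have hA : ∀ a ∈ A, Abelianization.of a = 1 := fun a ha => by
    by_cases ha1 : a = 1
    · rw [ha1, map_one]
    obtain ⟨x, hx, hx1, hxa, hxi⟩ := exists_mem_ne_of_four_le hcard a
    have hxa' : x * a ≠ 1 := fun e => hxi (eq_inv_of_mul_eq_one_left e)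
    have hax : a * x ≠ 1 := fun e => hxi (eq_inv_of_mul_eq_one_right e)
    have k {y z : X} := h.map_relation hb hinv Abelianization.of (x := y) (a := z)
    have k₁ := k hx hx1 ha ha1 hxa'
    by_cases haa : a * a = 1
    · have k₂ := k ha ha1 hx hx1 hax
      have k₃ : Abelianization.of a * Abelianization.of a = 1 := by
        rw [← map_mul, haa, map_one]
      rw [k₃, one_mul] at k₂
      rwa [k₂, one_mul, one_mul] at k₁
    · have k₂ := k ha ha1 ha ha1 haa
      have k₃ := k hx hx1 (inv_mem ha) (inv_ne_one.mpr ha1)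
        (fun e => hxa (mul_inv_eq_one.mp e))
      have k₄ : Abelianization.of a = (Abelianization.of a)⁻¹ := by
        rw [← map_inv]
        exact mul_left_cancel (k₁.trans k₃.symm)
      rwa [mul_eq_one_iff_eq_inv.mpr k₄, one_mul] at k₂
  have hker : (Abelianization.of : X →* Abelianization X).ker = ⊤ := by
    rw [eq_top_iff, ← h.gen, sup_le_iff]
    refine ⟨hA, fun b hbB => ?_⟩
    rw [MonoidHom.mem_ker]
    by_cases hb1 : b = 1
    · rw [hb1, map_one]
    obtain ⟨a, ha, ha1, e⟩ := h.exA b hbB hb1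
    rw [h.map_eq_inv hb hinv _ ha ha1 hbB e.symm, hA a ha, inv_one]
  rwa [Abelianization.ker_of] at hker
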